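/- Let N ≥ 1 and suppose that for each time level k = 0, …, N−1 the grid functions h^k, h^{k+1}, u^k, u^{k+1}, v^k, v^{k+1}, b together with constants g ≥ 0, ω ∈ ℝ, Δt > 0, η > 0, ζ ∈ (0,1) satisfy the finite volume scheme with stabilisation terms q^{k+1}_{i,j} = ηΔt(∂xφ^{k+1}_{i,j} − ω v^k_{i,j}) and r^{k+1}_{i,j} = ηΔt(∂yφ^{k+1}_{i,j} + ω u^k_{i,j}), that h^{k+1}_{i,j} > 0 for all (i,j), and that conditions (1) η > (3/2)h^{k+1}_{i,j}, (2) 1 + (3Δt/h^{k+1}_{i,j})·[(F^{k+1,−}_{i+1/2,j} − F^{k+1,+}_{i−1/2,j})/Δx + (G^{k+1,−}_{i,j+1/2} − G^{k+1,+}_{i,j−1/2})/Δy] ≥ 0, and (3) Δt² · 3ω²η² ≤ ζ · 2h^{k+1}_{i,j} · (η − (3/2)h^{k+1}_{i,j}) hold for all (i,j) and all k. Then for every 1 ≤ n ≤ N the global energy estimate holds: Σ_{i,j} Δx Δy Eⁿ_{i,j} + (g/2) Σ_{k=0}^{n−1} Σ_{i,j} Δx Δy (h^{k+1}_{i,j}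 − h^k_{i,j})² + Σ_{k=0}^{n−1} Σ_{i,j} Δx Δy ((1−ζ)/η²)(η − (3/2)h^{k+1}_{i,j})((q^{k+1}_{i,j})² + (r^{k+1}_{i,j})²) ≤ Σ_{i,j} Δx Δy E⁰_{i,j}, where E^k_{i,j} = ½ g (h^k_{i,j})² + g b_{i,j} h^k_{i,j} + ½ h^k_{i,j}((u^k_{i,j})² + (v^k_{i,j})²). -/

import Mathlib

/-- Cell indices of a uniform periodic grid with `Nx × Ny` cells. -/
abbrev Idx (Nx Ny : ℕ) := ZMod Nx × ZMod Ny

/-- A grid function on a uniform periodic grid with `Nx × Ny` cells. -/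
abbrev Grid (Nx Ny : ℕ) := Idx Nx Ny → ℝ

variable {Nx Ny : ℕ}

/-- Shift the index one cell in the positive `x` direction. -/
def shXp (p : Idx Nx Ny) : Idx Nx Ny := (p.1 + 1, p.2)

/-- Shift the index one cell in the negative `x` direction. -/
def shXm (p : Idx Nx Ny) : Idx Nx Ny := (p.1 - 1, p.2)

/-- Shift the index one cell in the positive `y` direction. -/
def shYp (p : Idx Nx Ny) : Idx Nx Ny := (p.1, p.2 + 1)

/-- Shift the index one cell in the negative `y` direction. -/
def shYm (p : Idx Nx Ny) : Idx Nx Ny := (p.1, p.2 - 1)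

/-- Central discrete derivative in `x`: `(z_{i+1,j} − z_{i−1,j})/(2Δx)`. -/
noncomputable def dX (Δx : ℝ) (z : Grid Nx Ny) : Grid Nx Ny :=
  fun p => (z (shXp p) - z (shXm p)) / (2 * Δx)

/-- Central discrete derivative in `y`: `(z_{i,j+1} − z_{i,j−1})/(2Δy)`. -/
noncomputable def dY (Δy : ℝ) (z : Grid Nx Ny) : Grid Nx Ny :=
  fun p => (z (shYp p) - z (shYm p)) / (2 * Δy)

/-- Average of a grid function at the vertical edge `(i+1/2, j)`. -/
noncomputable def avgX (z : Grid Nx Ny) : Grid Nx Ny := fun p => (z p + z (shXp p)) / 2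

/-- Average of a grid function at the horizontal edge `(i, j+1/2)`. -/
noncomputable def avgY (z : Grid Nx Ny) : Grid Nx Ny := fun p => (z p + z (shYp p)) / 2

/-- Numerical mass flux `F^{n+1}_{i+1/2,j} = {{h^{n+1}u^n}}_{i+1/2,j} − {{q^{n+1}}}_{i+1/2,j}`. -/
noncomputable def fluxF (h1 u0 q1 : Grid Nx Ny) : Grid Nx Ny :=
  fun p => avgX (fun s => h1 s * u0 s) p - avgX q1 p

/-- Numerical mass flux `G^{n+1}_{i,j+1/2} = {{h^{n+1}v^n}}_{i,j+1/2} − {{r^{n+1}}}_{i,j+1/2}`. -/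
noncomputable def fluxG (h1 v0 r1 : Grid Nx Ny) : Grid Nx Ny :=
  fun p => avgY (fun s => h1 s * v0 s) p - avgY r1 p

/-- Upwind edge value at a vertical edge with respect to the flux `F`. -/
noncomputable def upX (F w : Grid Nx Ny) : Grid Nx Ny :=
  fun p => if 0 ≤ F p then w p else w (shXp p)

/-- Upwind edge value at a horizontal edge with respect to the flux `G`. -/
noncomputable def upY (G w : Grid Nx Ny) : Grid Nx Ny :=
  fun p => if 0 ≤ G p then w p else w (shYp p)

/-- The semi-implicit finite volume scheme for the rotating shallow water system:
mass balance and both momentum balances, relating the solution `(h0, u0, v0)` at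
time level `n` to the solution `(h1, u1, v1)` at time level `n+1`, with bottom
topography `b` and stabilisation terms `q1`, `r1`. -/
def Scheme (Δx Δy Δt g ω : ℝ) (h0 h1 u0 u1 v0 v1 b q1 r1 : Grid Nx Ny) : Prop :=
  (∀ p : Idx Nx Ny,
    (h1 p - h0 p) / Δt
      + (fluxF h1 u0 q1 p - fluxF h1 u0 q1 (shXm p)) / Δx
      + (fluxG h1 v0 r1 p - fluxG h1 v0 r1 (shYm p)) / Δy = 0) ∧
  (∀ p : Idx Nx Ny,
    (h1 p * u1 p - h0 p * u0 p) / Δt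
      + (fluxF h1 u0 q1 p * upX (fluxF h1 u0 q1) u0 p
          - fluxF h1 u0 q1 (shXm p) * upX (fluxF h1 u0 q1) u0 (shXm p)) / Δx
      + (fluxG h1 v0 r1 p * upY (fluxG h1 v0 r1) u0 p
          - fluxG h1 v0 r1 (shYm p) * upY (fluxG h1 v0 r1) u0 (shYm p)) / Δy
      + h1 p * dX Δx (fun s => g * (h1 s + b s)) p
      = ω * h1 p * v0 p - ω * r1 p) ∧
  (∀ p : Idx Nx Ny,
    (h1 p * v1 p - h0 p * v0 p) / Δt
      + (fluxF h1 u0 q1 p * upX (fluxF h1 u0 q1) v0 p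
          - fluxF h1 u0 q1 (shXm p) * upX (fluxF h1 u0 q1) v0 (shXm p)) / Δx
      + (fluxG h1 v0 r1 p * upY (fluxG h1 v0 r1) v0 p
          - fluxG h1 v0 r1 (shYm p) * upY (fluxG h1 v0 r1) v0 (shYm p)) / Δy
      + h1 p * dY Δy (fun s => g * (h1 s + b s)) p
      = -(ω * h1 p * u0 p) + ω * q1 p)

/-- Discrete total energy `E = ½gh² + gbh + ½h(u² + v²)`. -/
noncomputable def Etot (g : ℝ) (b h u v : Grid Nx Ny) : Grid Nx Ny :=
  fun p => (1/2) * g * (h p) ^ 2 + g * b p * h p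
    + (1/2) * h p * ((u p) ^ 2 + (v p) ^ 2)

/-- Weighted Cauchy–Schwarz bound for the squared increment of a velocity component. -/
lemma increment_sq_le {H dt a₁ a₂ a₃ a₄ d₁ d₂ d₃ d₄ X Y δ : ℝ} (hH : 0 < H) (hdt : 0 < dt)
    (h₁ : 0 ≤ a₁) (h₂ : 0 ≤ a₂) (h₃ : 0 ≤ a₃) (h₄ : 0 ≤ a₄)
    (cfl : 3 * dt * (a₁ + a₂ + a₃ + a₄) ≤ H)
    (hδ : H * δ = dt * (a₁ * d₁ + a₂ * d₂ + a₃ * d₃ + a₄ * d₄) - X - Y) :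
    H * δ ^ 2 ≤ dt * (a₁ * d₁ ^ 2 + a₂ * d₂ ^ 2 + a₃ * d₃ ^ 2 + a₄ * d₄ ^ 2)
      + 3 / H * (X ^ 2 + Y ^ 2) := by
  set A := a₁ * d₁ + a₂ * d₂ + a₃ * d₃ + a₄ * d₄ with hA
  set B := a₁ * d₁ ^ 2 + a₂ * d₂ ^ 2 + a₃ * d₃ ^ 2 + a₄ * d₄ ^ 2 with hB
  have hB0 : 0 ≤ B := by positivity
  have cauchy : A ^ 2 ≤ (a₁ + a₂ + a₃ + a₄) * B := by
    have : (a₁ + a₂ + a₃ + a₄) * B - A ^ 2 =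
        a₁ * a₂ * (d₁ - d₂) ^ 2 + a₁ * a₃ * (d₁ - d₃) ^ 2 + a₁ * a₄ * (d₁ - d₄) ^ 2
        + a₂ * a₃ * (d₂ - d₃) ^ 2 + a₂ * a₄ * (d₂ - d₄) ^ 2 + a₃ * a₄ * (d₃ - d₄) ^ 2 := by
      rw [hA, hB]; ring
    have : 0 ≤ (a₁ + a₂ + a₃ + a₄) * B - A ^ 2 := by rw [this]; positivity
    linarith
  have weighted : 3 * (dt * A) ^ 2 ≤ H * (dt * B) := by
    calc 3 * (dt * A) ^ 2 = 3 * dt ^ 2 * A ^ 2 := by ring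
      _ ≤ 3 * dt ^ 2 * ((a₁ + a₂ + a₃ + a₄) * B) := by gcongr
      _ = 3 * dt * (a₁ + a₂ + a₃ + a₄) * (dt * B) := by ring
      _ ≤ H * (dt * B) := by gcongr
  have three : (H * δ) ^ 2 ≤ 3 * (dt * A) ^ 2 + 3 * (X ^ 2 + Y ^ 2) := by
    rw [hδ]
    nlinarith [sq_nonneg (dt * A + X), sq_nonneg (dt * A + Y), sq_nonneg (X - Y)]
  refine le_of_mul_le_mul_left ?_ hH
  have : H * (dt * B + 3 / H * (X ^ 2 + Y ^ 2)) = H * (dt * B) + 3 * (X ^ 2 + Y ^ 2) := by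
    field_simp
  rw [this]
  linarith [mul_pow H δ 2, show H * (H * δ ^ 2) = (H * δ) ^ 2 by ring]

/-- Upwind flux through an edge with mass flux `F` and left/right values `a`, `b`. -/
noncomputable def upwindFlux (F a b : ℝ) : ℝ := max F 0 * a + min F 0 * b

lemma mul_upX (F w : Grid Nx Ny) (p : Idx Nx Ny) :
    F p * upX F w p = upwindFlux (F p) (w p) (w (shXp p)) := by
  unfold upX upwindFlux
  split_ifs with hF
  · simp [hF]
  · simp [(not_le.mp hF).le]

lemma mul_upY (F w : Grid Nx Ny) (p : Idx Nx Ny) :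
    F p * upY F w p = upwindFlux (F p) (w p) (w (shYp p)) := by
  unfold upY upwindFlux
  split_ifs with hF
  · simp [hF]
  · simp [(not_le.mp hF).le]

/-- Local kinetic energy balance for one velocity component, with source `-(X + Y)`. -/
lemma kinetic_energy_le {h0 h1 w0 w1 wE wW wN wS Fp Fm Gp Gm X Y dt dx dy : ℝ}
    (hH : 0 < h1) (hdt : 0 < dt) (hdx : 0 < dx) (hdy : 0 < dy)
    (mass : (h1 - h0) / dt + (Fp - Fm) / dx + (Gp - Gm) / dy = 0)
    (mom : (h1 * w1 - h0 * w0) / dt + (upwindFlux Fp w0 wE - upwindFlux Fm wW w0) / dx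
      + (upwindFlux Gp w0 wN - upwindFlux Gm wS w0) / dy = -(X + Y) / dt)
    (cfl : 0 ≤ 1 + (3 * dt / h1) *
      ((min Fp 0 - max Fm 0) / dx + (min Gp 0 - max Gm 0) / dy)) :
    1 / 2 * h1 * w1 ^ 2 - 1 / 2 * h0 * w0 ^ 2 ≤
      -(dt / 2) * ((upwindFlux Fp (w0 ^ 2) (wE ^ 2) - upwindFlux Fm (wW ^ 2) (w0 ^ 2)) / dx
        + (upwindFlux Gp (w0 ^ 2) (wN ^ 2) - upwindFlux Gm (wS ^ 2) (w0 ^ 2)) / dy)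
      - w0 * (X + Y) + 3 / (2 * h1) * (X ^ 2 + Y ^ 2) := by
  have hm : h0 = h1 + dt * ((max Fp 0 + min Fp 0 - (max Fm 0 + min Fm 0)) / dx
      + (max Gp 0 + min Gp 0 - (max Gm 0 + min Gm 0)) / dy) := by
    rw [max_add_min, max_add_min, max_add_min, max_add_min]
    simp only [add_zero]
    field_simp at mass ⊢
    linarith
  have hM : h1 * w1 - h0 * w0 = -(X + Y) - dt *
      ((upwindFlux Fp w0 wE - upwindFlux Fm wW w0) / dx
      + (upwindFlux Gp w0 wN - upwindFlux Gm wS w0) / dy) := by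
    field_simp at mom ⊢
    linarith
  have hcfl : 3 * dt * (-min Fp 0 / dx + max Fm 0 / dx + -min Gp 0 / dy + max Gm 0 / dy)
      ≤ h1 := by
    have := mul_nonneg hH.le cfl
    have e : h1 * (1 + (3 * dt / h1) *
      ((min Fp 0 - max Fm 0) / dx + (min Gp 0 - max Gm 0) / dy)) =
      h1 - 3 * dt * (-min Fp 0 / dx + max Fm 0 / dx + -min Gp 0 / dy + max Gm 0 / dy) := by
      field_simp
      ring
    linarith
  have key := increment_sq_le (δ := w1 - w0) (d₁ := wE - w0) (d₂ := wW - w0) (d₃ := wN - w0)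
    (d₄ := wS - w0) (X := X) (Y := Y) hH hdt
    (div_nonneg (neg_nonneg.mpr (min_le_right Fp 0)) hdx.le)
    (div_nonneg (le_max_right Fm 0) hdx.le)
    (div_nonneg (neg_nonneg.mpr (min_le_right Gp 0)) hdy.le)
    (div_nonneg (le_max_right Gm 0) hdy.le) hcfl (by
      unfold upwindFlux at hM
      linear_combination hM + w0 * hm)
  unfold upwindFlux at hM ⊢
  have e : 3 / (2 * h1) * (X ^ 2 + Y ^ 2) = 1 / 2 * (3 / h1 * (X ^ 2 + Y ^ 2)) := by
    field_simp
  rw [e]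
  linear_combination 1 / 2 * key + w0 * hM + 1 / 2 * w0 ^ 2 * hm

lemma sum_shXp [NeZero Nx] [NeZero Ny] (f : Grid Nx Ny) : ∑ p, f (shXp p) = ∑ p, f p :=
  Equiv.sum_comp ((Equiv.addRight (1 : ZMod Nx)).prodCongr (Equiv.refl (ZMod Ny))) f

lemma sum_shYp [NeZero Nx] [NeZero Ny] (f : Grid Nx Ny) : ∑ p, f (shYp p) = ∑ p, f p :=
  Equiv.sum_comp ((Equiv.refl (ZMod Nx)).prodCongr (Equiv.addRight (1 : ZMod Ny))) f

lemma shXp_shXm (p : Idx Nx Ny) : shXp (shXm p) = p := by simp [shXp, shXm]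

lemma shXm_shXp (p : Idx Nx Ny) : shXm (shXp p) = p := by simp [shXp, shXm]

lemma shYp_shYm (p : Idx Nx Ny) : shYp (shYm p) = p := by simp [shYp, shYm]

lemma shYm_shYp (p : Idx Nx Ny) : shYm (shYp p) = p := by simp [shYp, shYm]

lemma sum_shXm [NeZero Nx] [NeZero Ny] (f : Grid Nx Ny) : ∑ p, f (shXm p) = ∑ p, f p := by
  rw [← sum_shXp]; simp only [shXm_shXp]

lemma sum_shYm [NeZero Nx] [NeZero Ny] (f : Grid Nx Ny) : ∑ p, f (shYm p) = ∑ p, f p := by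
  rw [← sum_shYp]; simp only [shYm_shYp]

/-- Discrete integration by parts in `x`. -/
lemma sum_mul_div_avgX [NeZero Nx] [NeZero Ny] {Δx : ℝ} (φ z : Grid Nx Ny) :
    ∑ p, (φ p * ((avgX z p - avgX z (shXm p)) / Δx) + dX Δx φ p * z p) = 0 := by
  have e : ∀ p, φ p * ((avgX z p - avgX z (shXm p)) / Δx) + dX Δx φ p * z p =
      (fun s => (φ s * z (shXp s) + φ (shXp s) * z s) / (2 * Δx)) p
      - (fun s => (φ s * z (shXp s) + φ (shXp s) * z s) / (2 * Δx)) (shXm p) := by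
    intro p
    simp only [avgX, dX, shXp_shXm]
    ring
  rw [Finset.sum_congr rfl fun p _ => e p, Finset.sum_sub_distrib,
    sum_shXm fun s => (φ s * z (shXp s) + φ (shXp s) * z s) / (2 * Δx), sub_self]

/-- Discrete integration by parts in `y`. -/
lemma sum_mul_div_avgY [NeZero Nx] [NeZero Ny] {Δy : ℝ} (φ z : Grid Nx Ny) :
    ∑ p, (φ p * ((avgY z p - avgY z (shYm p)) / Δy) + dY Δy φ p * z p) = 0 := by
  have e : ∀ p, φ p * ((avgY z p - avgY z (shYm p)) / Δy) + dY Δy φ p * z p =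
      (fun s => (φ s * z (shYp s) + φ (shYp s) * z s) / (2 * Δy)) p
      - (fun s => (φ s * z (shYp s) + φ (shYp s) * z s) / (2 * Δy)) (shYm p) := by
    intro p
    simp only [avgY, dY, shYp_shYm]
    ring
  rw [Finset.sum_congr rfl fun p _ => e p, Finset.sum_sub_distrib,
    sum_shYm fun s => (φ s * z (shYp s) + φ (shYp s) * z s) / (2 * Δy), sub_self]

lemma fluxF_eq_avgX (h u q : Grid Nx Ny) : fluxF h u q = avgX (fun s => h s * u s - q s) := by
  funext p; simp only [fluxF, avgX]; ring

lemma fluxG_eq_avgY (h v r : Grid Nx Ny) : fluxG h v r = avgY (fun s => h s * v s - r s) := by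
  funext p; simp only [fluxG, avgY]; ring

/-- The stabilisation and Coriolis parts of the velocity increments are controlled by the
stabilisation dissipation. -/
lemma residual_le {H η ζ ω dt Q R : ℝ} (hH : 0 < H) (hη : 0 < η)
    (cond3 : dt ^ 2 * (3 * ω ^ 2 * η ^ 2) ≤ ζ * (2 * H) * (η - (3/2) * H)) :
    3 / (2 * H) * ((H * Q / η) ^ 2 + (dt * ω * R) ^ 2)
      + 3 / (2 * H) * ((H * R / η) ^ 2 + (-(dt * ω * Q)) ^ 2)
      ≤ (Q ^ 2 + R ^ 2) / η
        - (1 - ζ) / η ^ 2 * (η - (3/2) * H) * (Q ^ 2 + R ^ 2) := by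
  have e : (Q ^ 2 + R ^ 2) / η - (1 - ζ) / η ^ 2 * (η - (3/2) * H) * (Q ^ 2 + R ^ 2)
      - (3 / (2 * H) * ((H * Q / η) ^ 2 + (dt * ω * R) ^ 2)
      + 3 / (2 * H) * ((H * R / η) ^ 2 + (-(dt * ω * Q)) ^ 2))
      = (ζ * (2 * H) * (η - (3/2) * H) - dt ^ 2 * (3 * ω ^ 2 * η ^ 2))
        * (Q ^ 2 + R ^ 2) / (2 * H * η ^ 2) := by
    field_simp
    ring
  have := sub_nonneg.mpr cond3
  rw [← sub_nonneg, e]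
  positivity

/-- Energy dissipation over a single time step. -/
lemma energy_step [NeZero Nx] [NeZero Ny]
    {Δx Δy Δt g ω η ζ : ℝ} (hΔx : 0 < Δx) (hΔy : 0 < Δy) (hΔt : 0 < Δt) (hη : 0 < η)
    {h0 h1 u0 u1 v0 v1 b q r : Grid Nx Ny}
    (hq : q = fun p => η * Δt * (dX Δx (fun s => g * (h1 s + b s)) p - ω * v0 p))
    (hr : r = fun p => η * Δt * (dY Δy (fun s => g * (h1 s + b s)) p + ω * u0 p))
    (hs : Scheme Δx Δy Δt g ω h0 h1 u0 u1 v0 v1 b q r)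
    (hpos : ∀ p, 0 < h1 p)
    (cond2 : ∀ p, 0 ≤ 1 + (3 * Δt / h1 p) *
        ((min (fluxF h1 u0 q p) 0 - max (fluxF h1 u0 q (shXm p)) 0) / Δx
          + (min (fluxG h1 v0 r p) 0 - max (fluxG h1 v0 r (shYm p)) 0) / Δy))
    (cond3 : ∀ p, Δt ^ 2 * (3 * ω ^ 2 * η ^ 2) ≤ ζ * (2 * h1 p) * (η - (3/2) * h1 p)) :
    (∑ p, Etot g b h1 u1 v1 p) + (g / 2) * ∑ p, (h1 p - h0 p) ^ 2
      + ∑ p, ((1 - ζ) / η ^ 2) * (η - (3/2) * h1 p) * ((q p) ^ 2 + (r p) ^ 2)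
      ≤ ∑ p, Etot g b h0 u0 v0 p := by
  obtain ⟨mass, momU, momV⟩ := hs
  set φ : Grid Nx Ny := fun s => g * (h1 s + b s)
  set F := fluxF h1 u0 q with hF
  set G := fluxG h1 v0 r with hG
  set KF : Grid Nx Ny := fun p =>
    F p * upX F (fun s => u0 s ^ 2) p + F p * upX F (fun s => v0 s ^ 2) p with hKF
  set KG : Grid Nx Ny := fun p =>
    G p * upY G (fun s => u0 s ^ 2) p + G p * upY G (fun s => v0 s ^ 2) p with hKG
  have hqφ : ∀ p, Δt * dX Δx φ p = q p / η + Δt * ω * v0 p := by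
    intro p; rw [hq]; field_simp; ring
  have hrφ : ∀ p, Δt * dY Δy φ p = r p / η - Δt * ω * u0 p := by
    intro p; rw [hr]; field_simp; ring
  have pointwise : ∀ p, Etot g b h1 u1 v1 p + (g / 2) * (h1 p - h0 p) ^ 2
      + ((1 - ζ) / η ^ 2) * (η - (3/2) * h1 p) * ((q p) ^ 2 + (r p) ^ 2)
      - Etot g b h0 u0 v0 p ≤
      -(Δt / 2) * ((KF p - KF (shXm p)) / Δx + (KG p - KG (shYm p)) / Δy)
      - Δt * (φ p * ((F p - F (shXm p)) / Δx) + dX Δx φ p * (h1 p * u0 p - q p))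
      - Δt * (φ p * ((G p - G (shYm p)) / Δy) + dY Δy φ p * (h1 p * v0 p - r p)) := by
    intro p
    have m := mass p
    have mu := momU p
    have mv := momV p
    simp only [mul_upX, mul_upY, shXp_shXm, shYp_shYm] at mu mv
    have ku := kinetic_energy_le (X := h1 p * q p / η) (Y := Δt * ω * r p)
      (hpos p) hΔt hΔx hΔy m (by
        have : -(h1 p * q p / η + Δt * ω * r p) / Δt
            = ω * h1 p * v0 p - ω * r p - h1 p * dX Δx φ p := by
          rw [div_eq_iff hΔt.ne']
          linear_combination h1 p * hqφ p
        rw [this]; exact eq_sub_of_add_eq mu) (cond2 p)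
    have kv := kinetic_energy_le (X := h1 p * r p / η) (Y := -(Δt * ω * q p))
      (hpos p) hΔt hΔx hΔy m (by
        have : -(h1 p * r p / η + -(Δt * ω * q p)) / Δt
            = -(ω * h1 p * u0 p) + ω * q p - h1 p * dY Δy φ p := by
          rw [div_eq_iff hΔt.ne']
          linear_combination h1 p * hrφ p
        rw [this]; exact eq_sub_of_add_eq mv) (cond2 p)
    have res := residual_le (Q := q p) (R := r p) (hpos p) hη (cond3 p)
    have hm : h1 p - h0 p = -Δt * ((F p - F (shXm p)) / Δx + (G p - G (shYm p)) / Δy) := by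
      have : h1 p - h0 p = Δt * ((h1 p - h0 p) / Δt) := by field_simp
      rw [this]
      linear_combination Δt * m
    simp only [hKF, hKG, mul_upX, mul_upY, shXp_shXm, shYp_shYm, Etot]
    have hφp : φ p = g * (h1 p + b p) := rfl
    linear_combination ku + kv + res + φ p * hm
      + (h1 p * u0 p - q p) * hqφ p + (h1 p * v0 p - r p) * hrφ p
      - (h1 p - h0 p) * hφp
  have total := Finset.sum_le_sum fun p (_ : p ∈ Finset.univ) => pointwise p
  have hX := sum_mul_div_avgX (Δx := Δx) φ (fun s => h1 s * u0 s - q s)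
  have hY := sum_mul_div_avgY (Δy := Δy) φ (fun s => h1 s * v0 s - r s)
  rw [← fluxF_eq_avgX, ← hF] at hX
  rw [← fluxG_eq_avgY, ← hG] at hY
  have tX : ∑ p, (KF p - KF (shXm p)) / Δx = 0 := by
    rw [← Finset.sum_div, Finset.sum_sub_distrib, sum_shXm, sub_self, zero_div]
  have tY : ∑ p, (KG p - KG (shYm p)) / Δy = 0 := by
    rw [← Finset.sum_div, Finset.sum_sub_distrib, sum_shYm, sub_self, zero_div]
  rw [Finset.sum_sub_distrib, Finset.sum_add_distrib, Finset.sum_add_distrib,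
    Finset.sum_sub_distrib, Finset.sum_sub_distrib, ← Finset.mul_sum, ← Finset.mul_sum,
    ← Finset.mul_sum, ← Finset.mul_sum, hX, hY, Finset.sum_add_distrib, tX, tY] at total
  linarith

/-- Global energy estimate for the finite volume scheme with stabilisation
terms; `q k` and `r k` denote the stabilisation terms `q^{k+1}`, `r^{k+1}`
used in the update from time level `k` to `k+1`. -/
theorem stmt_11 (Nx Ny : ℕ) [NeZero Nx] [NeZero Ny] (N : ℕ) (hN : 1 ≤ N)
    (Δx Δy Δt g ω η ζ : ℝ) (hΔx : 0 < Δx) (hΔy : 0 < Δy) (hΔt : 0 < Δt)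
    (hg : 0 ≤ g) (hη : 0 < η) (hζ : ζ ∈ Set.Ioo (0:ℝ) 1)
    (h u v : ℕ → Grid Nx Ny) (b : Grid Nx Ny) (q r : ℕ → Grid Nx Ny)
    (hq : ∀ k, k < N → q k = fun p =>
      η * Δt * (dX Δx (fun s => g * (h (k+1) s + b s)) p - ω * v k p))
    (hr : ∀ k, k < N → r k = fun p =>
      η * Δt * (dY Δy (fun s => g * (h (k+1) s + b s)) p + ω * u k p))
    (hs : ∀ k, k < N →
      Scheme Δx Δy Δt g ω (h k) (h (k+1)) (u k) (u (k+1)) (v k) (v (k+1)) b (q k) (r k))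
    (hpos : ∀ k, k < N → ∀ p : Idx Nx Ny, 0 < h (k+1) p)
    (cond1 : ∀ k, k < N → ∀ p : Idx Nx Ny, η > (3/2) * h (k+1) p)
    (cond2 : ∀ k, k < N → ∀ p : Idx Nx Ny,
      0 ≤ 1 + (3 * Δt / h (k+1) p) *
        ((min (fluxF (h (k+1)) (u k) (q k) p) 0
            - max (fluxF (h (k+1)) (u k) (q k) (shXm p)) 0) / Δx
          + (min (fluxG (h (k+1)) (v k) (r k) p) 0
            - max (fluxG (h (k+1)) (v k) (r k) (shYm p)) 0) / Δy))
    (cond3 : ∀ k, k < N → ∀ p : Idx Nx Ny,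
      Δt ^ 2 * (3 * ω ^ 2 * η ^ 2) ≤ ζ * (2 * h (k+1) p) * (η - (3/2) * h (k+1) p)) :
    ∀ n, 1 ≤ n → n ≤ N →
      (∑ p : Idx Nx Ny, Δx * Δy * Etot g b (h n) (u n) (v n) p)
      + (g / 2) * ∑ k ∈ Finset.range n, ∑ p : Idx Nx Ny,
          Δx * Δy * (h (k+1) p - h k p) ^ 2
      + ∑ k ∈ Finset.range n, ∑ p : Idx Nx Ny,
          Δx * Δy * ((1 - ζ) / η ^ 2) * (η - (3/2) * h (k+1) p)
            * ((q k p) ^ 2 + (r k p) ^ 2)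
      ≤ ∑ p : Idx Nx Ny, Δx * Δy * Etot g b (h 0) (u 0) (v 0) p := by
  rintro n - hn
  induction n with
  | zero => simp
  | succ n ih =>
    have hlt : n < N := hn
    have prev := ih hlt.le
    have step := mul_le_mul_of_nonneg_left
      (energy_step hΔx hΔy hΔt hη (hq n hlt) (hr n hlt) (hs n hlt) (hpos n hlt)
        (cond2 n hlt) (cond3 n hlt)) (mul_pos hΔx hΔy).le
    rw [Finset.sum_range_succ, Finset.sum_range_succ]
    simp only [mul_assoc, ← Finset.mul_sum] at step prev ⊢
    linarith
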